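/- arXiv:1709.07370 — 3 statements merged into one kernel-verified Lean document; each statement's English description precedes it below -/
import Mathlib

section
/- Let √z denote the principal branch of the complex square root. For every z ∈ ℂ with Im z > 0, the function V(z) = −√z/(√z + 2i) satisfies Im(V(z)/z) > 0. Hence V from Example 2 satisfies the inverse Stieltjes positivity condition Im(V(z)/z)/Im z ≥ 0 on the upper half-plane. -/
open Complex

theorem cpow_one_half_re_pos {z : ℂ} (hz : 0 < z.im) : 0 < (z ^ ((1 : ℂ) / 2)).re := by
  rw [one_div, cpow_inv_two_re]
  have h : -z.re < ‖z‖ :=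
    (neg_le_abs z.re).trans_lt (abs_re_lt_norm.mpr hz.ne')
  exact Real.sqrt_pos.mpr (by linarith)

theorem im_neg_div_add_two_I_div_sq_pos {w : ℂ} (hre : 0 < w.re) (him : 0 < (w ^ 2).im) :
    0 < ((-w / (w + 2 * I)) / w ^ 2).im := by
  have hw : w ≠ 0 := fun h => by simp [h] at hre
  have hw' : w + 2 * I ≠ 0 := fun h => by
    have := congrArg re h
    simp at this
    exact hre.ne' this
  have heq : (-w / (w + 2 * I)) / w ^ 2 = -(w ^ 2 + 2 * I * w)⁻¹ := by
    rw [show w ^ 2 + 2 * I * w = w * (w + 2 * I) by ring]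
    field_simp
  have hne : w ^ 2 + 2 * I * w ≠ 0 := by
    rw [show w ^ 2 + 2 * I * w = w * (w + 2 * I) by ring]
    exact mul_ne_zero hw hw'
  have hpos : 0 < (w ^ 2 + 2 * I * w).im := by
    have h : (2 * I * w).im = 2 * w.re := by simp
    rw [add_im, h]
    positivity
  rw [heq, neg_im, inv_im, neg_div, neg_neg]
  exact div_pos hpos (normSq_pos.mpr hne)

/-- Example 2: `V(z) = -√z/(√z + 2i)` (principal branch) satisfies
`Im (V(z)/z) > 0` on the upper half-plane; hence the inverse Stieltjes
positivity condition `Im (V(z)/z) / Im z ≥ 0` holds there. -/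
theorem example2_inverse_stieltjes_positivity :
    ∀ z : ℂ, 0 < z.im →
      0 < ((-(z ^ ((1 : ℂ) / 2)) / (z ^ ((1 : ℂ) / 2) + 2 * I)) / z).im ∧
      0 ≤ ((-(z ^ ((1 : ℂ) / 2)) / (z ^ ((1 : ℂ) / 2) + 2 * I)) / z).im / z.im := by
  intro z hz
  have hsq : (z ^ ((1 : ℂ) / 2)) ^ 2 = z := by
    rw [one_div]
    exact cpow_nat_inv_pow z two_ne_zero
  have hpos := im_neg_div_add_two_I_div_sq_pos (cpow_one_half_re_pos hz) (by rwa [hsq])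
  rw [hsq] at hpos
  exact ⟨hpos, div_nonneg hpos.le hz.le⟩
end

section
/- Let k, r, m be real numbers with k > 0 and m + r > 0, and set μ₀ = k²/(m+r) + r. Then the function f(μ) = ((m + μ)·k)/((μ − r)(m + r) − k²) + 2·√( (k/(μ − r)) · ((m + μ)·k)/((μ − r)(m + r) − k²) ) is strictly decreasing on the open interval (μ₀, +∞). -/
open Set

/-- The function `f(μ) = tan α₁ + 2√(tan α₁ tan α₂)` from the proof of Theorem 3 is
strictly decreasing on `(μ₀, ∞)`, where `μ₀ = k²/(m+r) + r`. -/
theorem sectoriality_function_strictAntiOn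
    (k r m : ℝ) (hk : 0 < k) (hmr : 0 < m + r) :
    StrictAntiOn
      (fun μ : ℝ =>
        ((m + μ) * k) / ((μ - r) * (m + r) - k ^ 2) +
          2 * Real.sqrt ((k / (μ - r)) * (((m + μ) * k) / ((μ - r) * (m + r) - k ^ 2))))
      (Ioi (k ^ 2 / (m + r) + r)) := by
  have pos : ∀ μ ∈ Ioi (k ^ 2 / (m + r) + r),
      0 < μ - r ∧ 0 < m + μ ∧ 0 < (μ - r) * (m + r) - k ^ 2 := by
    intro μ hμ
    have h : k ^ 2 / (m + r) < μ - r := lt_sub_iff_add_lt.mpr hμ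
    have hx : 0 < μ - r := lt_trans (by positivity) h
    exact ⟨hx, by linarith, sub_pos.mpr ((div_lt_iff₀ hmr).mp h)⟩
  intro x hx y hy hxy
  obtain ⟨hx₁, hx₂, hx₃⟩ := pos x hx
  obtain ⟨hy₁, hy₂, hy₃⟩ := pos y hy
  have hlt : (m + y) * k / ((y - r) * (m + r) - k ^ 2) <
      (m + x) * k / ((x - r) * (m + r) - k ^ 2) := by
    rw [div_lt_div_iff₀ hy₃ hx₃]
    have h : 0 < k * ((y - x) * ((m + r) ^ 2 + k ^ 2)) :=
      mul_pos hk (mul_pos (sub_pos.mpr hxy) (by positivity))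
    linarith
  have hle : k / (y - r) ≤ k / (x - r) := by gcongr
  have hsqrt : Real.sqrt (k / (y - r) * ((m + y) * k / ((y - r) * (m + r) - k ^ 2))) ≤
      Real.sqrt (k / (x - r) * ((m + x) * k / ((x - r) * (m + r) - k ^ 2))) :=
    Real.sqrt_le_sqrt (mul_le_mul hle hlt.le (by positivity) (by positivity))
  dsimp only
  linarith
end

section
/- Let k, r, m be real numbers with k > 0 and m + r > 0. Then the function f̃(μ) = −((m + μ)·k)/((μ − r)(m + r) − k²) + 2·√( (k/(μ − r)) · ((m + μ)·k)/((μ − r)(m + r) − k²) ) is strictly increasing on the open interval (−m, r), and f̃(μ) → +∞ as μ → r from the left. -/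
open Set Filter

lemma neg_mul_div_pos {k r m μ : ℝ} (hk : 0 < k) (hmr : 0 < m + r) (hμ : μ ∈ Ioo (-m) r) :
    0 < -(((m + μ) * k) / ((μ - r) * (m + r) - k ^ 2)) := by
  have hden := mul_neg_of_neg_of_pos (sub_neg.2 hμ.2) hmr
  rw [neg_pos]
  exact div_neg_of_pos_of_neg (mul_pos (by linarith [hμ.1]) hk) (by linarith [pow_pos hk 2])

lemma strictMonoOn_neg_mul_div (k r m : ℝ) (hk : 0 < k) (hmr : 0 < m + r) :
    StrictMonoOn (fun μ : ℝ => -(((m + μ) * k) / ((μ - r) * (m + r) - k ^ 2)))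
      (Ioo (-m) r) := by
  intro x hx y hy hxy
  have hdx := mul_pos (sub_pos.2 hx.2) hmr
  have hdy := mul_pos (sub_pos.2 hy.2) hmr
  have hk2 := pow_pos hk 2
  have hxm : 0 < m + x := by linarith [hx.1]
  dsimp only
  rw [← div_neg, ← div_neg]
  exact div_lt_div₀ (mul_lt_mul_of_pos_right (by linarith) hk)
    (by nlinarith) (mul_pos (by linarith) hk).le (by linarith)

/-- In the accumulative case, the function
`f̃(μ) = -((m+μ)k)/((μ-r)(m+r) - k²) + 2√((k/(μ-r))·((m+μ)k)/((μ-r)(m+r) - k²))`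
is strictly increasing on `(-m, r)` and tends to `+∞` as `μ → r⁻`. -/
theorem accumulative_sectoriality_function
    (k r m : ℝ) (hk : 0 < k) (hmr : 0 < m + r) :
    StrictMonoOn
      (fun μ : ℝ =>
        -(((m + μ) * k) / ((μ - r) * (m + r) - k ^ 2)) +
          2 * Real.sqrt ((k / (μ - r)) * (((m + μ) * k) / ((μ - r) * (m + r) - k ^ 2))))
      (Ioo (-m) r) ∧
    Tendsto
      (fun μ : ℝ =>
        -(((m + μ) * k) / ((μ - r) * (m + r) - k ^ 2)) +
          2 * Real.sqrt ((k / (μ - r)) * (((m + μ) * k) / ((μ - r) * (m + r) - k ^ 2))))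
      (nhdsWithin r (Iio r)) atTop := by
  have hA := strictMonoOn_neg_mul_div k r m hk hmr
  refine ⟨fun x hx y hy hxy => ?_, ?_⟩
  · have hlt := hA hx hy hxy
    have hpos := neg_mul_div_pos hk hmr hx
    have hinv : -(k / (x - r)) ≤ -(k / (y - r)) := by
      rw [← div_neg, ← div_neg]
      exact div_le_div_of_nonneg_left hk.le (by linarith [hy.2]) (by linarith)
    have hinv0 : 0 ≤ -(k / (y - r)) := by
      rw [← div_neg]
      exact div_nonneg hk.le (by linarith [hy.2])
    have hsqrt := Real.sqrt_le_sqrt (mul_le_mul hinv hlt.le hpos.le hinv0)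
    simp only [neg_mul_neg] at hsqrt
    dsimp only at hlt ⊢
    linarith
  · have hc : Tendsto (fun μ : ℝ => ((m + μ) * k) / ((μ - r) * (m + r) - k ^ 2))
        (nhdsWithin r (Iio r)) (nhds (((m + r) * k) / ((r - r) * (m + r) - k ^ 2))) := by
      refine ContinuousAt.tendsto ?_ |>.mono_left nhdsWithin_le_nhds
      refine ContinuousAt.div (by fun_prop) (by fun_prop) ?_
      have := pow_pos hk 2
      linarith
    have hneg : ((m + r) * k) / ((r - r) * (m + r) - k ^ 2) < 0 :=
      div_neg_of_pos_of_neg (mul_pos hmr hk) (by linarith [pow_pos hk 2])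
    have hsub : Tendsto (fun μ : ℝ => μ - r) (nhdsWithin r (Iio r)) (nhdsWithin 0 (Iio 0)) := by
      refine tendsto_nhdsWithin_iff.2 ⟨?_, ?_⟩
      · have h : Continuous fun μ : ℝ => μ - r := by fun_prop
        exact (h.tendsto' r 0 (sub_self r)).mono_left nhdsWithin_le_nhds
      · filter_upwards [self_mem_nhdsWithin] with μ hμ
        exact sub_neg.2 (mem_Iio.1 hμ)
    have hinv : Tendsto (fun μ : ℝ => k / (μ - r)) (nhdsWithin r (Iio r)) atBot := by
      simp only [div_eq_mul_inv]
      exact (tendsto_inv_nhdsLT_zero.comp hsub).const_mul_atBot hk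
    exact hc.neg.add_atTop
      ((Real.tendsto_sqrt_atTop.comp (hinv.atBot_mul_neg hneg hc)).const_mul_atTop two_pos)
end
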